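/- (Tiles enumeration.) Let n ≥ d ≥ 0 with n ≥ 1, set k = n + d, and let C be a regular color map on T_k. Then the number of edges e of T_k with C(e) = m equals d(n − d), and it equals the number of edges e with C(e) = 3. Moreover, the number of direct faces whose three edges all have color 0 is (n−d)(n−d+1)/2, the number of reversed faces whose three edges all have color 0 is (n−d)(n−d−1)/2, the number of direct faces whose three edges all have color 1 is d(2d+1), and the number of reversed faces whose three edges all have color 1 is d(2d−1). -/

import Mathlib

noncomputable section

/-- The four possible colors of a puzzle edge: `0`, `1`, `3` and `m`. -/
inductive PColor
  | c0 | c1 | c3 | cm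
deriving DecidableEq

/-- The step of an edge of type `ℓ`: type `0` goes to `x+(−1,0)`, type `1` to `x+(1,−1)`,
type `2` to `x+(0,1)`. -/
def edgeStep : Fin 3 → ℤ × ℤ
  | 0 => (-1, 0)
  | 1 => (1, -1)
  | 2 => (0, 1)

/-- Vertices of the triangular grid `T_k`. -/
def TGrid (k : ℕ) : Set (ℤ × ℤ) := {x | 0 ≤ x.1 ∧ 0 ≤ x.2 ∧ x.1 + x.2 ≤ (k : ℤ)}

/-- The edge of type `ℓ` with origin `y` is an edge of `T_k`. -/
def IsEdge (k : ℕ) (ℓ : Fin 3) (y : ℤ × ℤ) : Prop :=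
  y ∈ TGrid k ∧ y + edgeStep ℓ ∈ TGrid k

/-- A triple of colors, read clockwise around a triangular face, is admissible if it is a
cyclic rotation of `(0,0,0)`, `(1,1,1)`, `(1,0,3)` or `(0,1,m)`. -/
def okTriple (a b c : PColor) : Prop :=
  (a = .c0 ∧ b = .c0 ∧ c = .c0) ∨ (a = .c1 ∧ b = .c1 ∧ c = .c1) ∨
  (a = .c1 ∧ b = .c0 ∧ c = .c3) ∨ (a = .c0 ∧ b = .c3 ∧ c = .c1) ∨
  (a = .c3 ∧ b = .c1 ∧ c = .c0) ∨
  (a = .c0 ∧ b = .c1 ∧ c = .cm) ∨ (a = .c1 ∧ b = .cm ∧ c = .c0) ∨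
  (a = .cm ∧ b = .c0 ∧ c = .c1)

/-- A color map on the triangular grid `T_k`. -/
def IsColorMap (k : ℕ) (C : Fin 3 → ℤ × ℤ → PColor) : Prop :=
  (∀ x : ℤ × ℤ, 0 ≤ x.1 → 0 ≤ x.2 → x.1 + x.2 + 1 ≤ (k : ℤ) →
    okTriple (C 2 x) (C 1 (x + (0, 1))) (C 0 (x + (1, 0)))) ∧
  (∀ x : ℤ × ℤ, 0 ≤ x.1 → 1 ≤ x.2 → x.1 + x.2 + 1 ≤ (k : ℤ) →
    okTriple (C 0 (x + (1, 0))) (C 2 (x + (1, -1))) (C 1 x))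

/-- The boundary color at height `h` on a side of `T_{n+d}` for a regular color map. -/
def bCol (n d : ℕ) (h : ℤ) : PColor :=
  if h < (d : ℤ) then .c1 else if h < (n : ℤ) then .c0 else .c1

/-- A regular color map on `T_{n+d}`. -/
def IsRegularColorMap (n d : ℕ) (C : Fin 3 → ℤ × ℤ → PColor) : Prop :=
  IsColorMap (n + d) C ∧
  (∀ h : ℤ, 0 ≤ h → h ≤ (n : ℤ) + d - 1 → C 0 ((n : ℤ) + d - h, 0) = bCol n d h) ∧
  (∀ h : ℤ, 0 ≤ h → h ≤ (n : ℤ) + d - 1 → C 1 (h, (n : ℤ) + d - h) = bCol n d h) ∧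
  (∀ h : ℤ, 0 ≤ h → h ≤ (n : ℤ) + d - 1 → C 2 (0, h) = bCol n d h)

/-- The sum of `f` over the pairs `(r, s)` with `r + s < k`. -/
def triSum (k : ℕ) (f : ℕ → ℕ → ℤ) : ℤ :=
  ∑ r ∈ Finset.range k, ∑ s ∈ Finset.range (k - r), f r s

theorem triSum_congr {k : ℕ} {f g : ℕ → ℕ → ℤ} (h : ∀ r s, r + s < k → f r s = g r s) :
    triSum k f = triSum k g := by
  refine Finset.sum_congr rfl fun r hr => Finset.sum_congr rfl fun s hs => h r s ?_
  simp only [Finset.mem_range] at hr hs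
  omega

theorem triSum_add (k : ℕ) (f g : ℕ → ℕ → ℤ) :
    triSum k (fun r s => f r s + g r s) = triSum k f + triSum k g := by
  simp only [triSum, Finset.sum_add_distrib]

theorem triSum_const_mul (k : ℕ) (a : ℤ) (f : ℕ → ℕ → ℤ) :
    triSum k (fun r s => a * f r s) = a * triSum k f := by
  simp only [triSum, Finset.mul_sum]

theorem triSum_succ_left (k : ℕ) (f : ℕ → ℕ → ℤ) :
    triSum (k + 1) f =
      triSum k (fun r s => f (r + 1) s) + ∑ i ∈ Finset.range (k + 1), f 0 i := by
  simp only [triSum]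
  rw [Finset.sum_range_succ']
  simp

theorem triSum_succ_right (k : ℕ) (f : ℕ → ℕ → ℤ) :
    triSum (k + 1) f =
      triSum k (fun r s => f r (s + 1)) + ∑ i ∈ Finset.range (k + 1), f i 0 := by
  have h : ∀ r ∈ Finset.range (k + 1), ∑ s ∈ Finset.range (k + 1 - r), f r s =
      ∑ s ∈ Finset.range (k - r), f r (s + 1) + f r 0 := fun r hr => by
    rw [← Finset.sum_range_succ', Nat.sub_add_comm (Finset.mem_range_succ_iff.1 hr)]
  rw [triSum, Finset.sum_congr rfl h, Finset.sum_add_distrib, Finset.sum_range_succ, triSum]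
  simp

theorem triSum_succ_diag (k : ℕ) (f : ℕ → ℕ → ℤ) :
    triSum (k + 1) f = triSum k f + ∑ i ∈ Finset.range (k + 1), f i (k - i) := by
  have h : ∀ r ∈ Finset.range (k + 1), ∑ s ∈ Finset.range (k + 1 - r), f r s =
      ∑ s ∈ Finset.range (k - r), f r s + f r (k - r) := fun r hr => by
    rw [← Finset.sum_range_succ, Nat.sub_add_comm (Finset.mem_range_succ_iff.1 hr)]
  rw [triSum, Finset.sum_congr rfl h, Finset.sum_add_distrib, Finset.sum_range_succ, triSum]
  simp

/-- Discrete Stokes formula: the sum over the direct faces minus the sum over the reversed faces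
of an edge weight is the sum of this weight over the boundary. -/
theorem triSum_stokes (k : ℕ) (f g h : ℕ → ℕ → ℤ) :
    triSum (k + 1) (fun r s => f r s + g r s + h r s) -
        triSum k (fun r s => f (r + 1) s + g r s + h r (s + 1)) =
      ∑ i ∈ Finset.range (k + 1), (f 0 i + g i (k - i) + h i 0) := by
  simp only [triSum_add, Finset.sum_add_distrib]
  rw [triSum_succ_left k f, triSum_succ_diag k g, triSum_succ_right k h]
  ring

/-- The number of pairs `(r, s)` with `r + s < k` satisfying a predicate, as a sum. -/
theorem ncard_eq_triSum (k : ℕ) (P : ℤ × ℤ → Prop) [DecidablePred P] :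
    (Set.ncard {x : ℤ × ℤ | (0 ≤ x.1 ∧ 0 ≤ x.2 ∧ x.1 + x.2 + 1 ≤ (k : ℤ)) ∧ P x} : ℤ) =
      triSum k (fun r s => if P (r, s) then 1 else 0) := by
  have hinj : Function.Injective
      (fun y : (_ : ℕ) × ℕ => (((y.1 : ℕ) : ℤ), ((y.2 : ℕ) : ℤ))) := by
    rintro ⟨a, b⟩ ⟨c, d⟩ h
    simp only [Prod.mk.injEq, Nat.cast_inj] at h
    rw [h.1, h.2]
  have hset : {x : ℤ × ℤ | (0 ≤ x.1 ∧ 0 ≤ x.2 ∧ x.1 + x.2 + 1 ≤ (k : ℤ)) ∧ P x} =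
      (fun y : (_ : ℕ) × ℕ => (((y.1 : ℕ) : ℤ), ((y.2 : ℕ) : ℤ))) ''
        ((((Finset.range k).sigma fun r => Finset.range (k - r)).filter
          fun y => P ((y.1 : ℕ), (y.2 : ℕ)) : Finset ((_ : ℕ) × ℕ)) : Set ((_ : ℕ) × ℕ)) := by
    ext ⟨x, y⟩
    simp only [Set.mem_ofPred_eq, Set.mem_image, Finset.coe_filter, Finset.mem_sigma,
      Finset.mem_range, Prod.mk.injEq]
    constructor
    · rintro ⟨⟨h1, h2, h3⟩, h4⟩
      lift x to ℕ using h1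
      lift y to ℕ using h2
      exact ⟨⟨x, y⟩, ⟨⟨by dsimp only; omega, by dsimp only; omega⟩, h4⟩, rfl, rfl⟩
    · rintro ⟨⟨r, s⟩, ⟨⟨h1, h2⟩, h3⟩, rfl, rfl⟩
      dsimp only at h1 h2 h3
      exact ⟨⟨Int.natCast_nonneg _, Int.natCast_nonneg _, by dsimp only; omega⟩, h3⟩
  rw [hset, Set.ncard_image_of_injective _ hinj, Set.ncard_coe_finset, Finset.card_filter,
    Finset.sum_sigma, triSum]
  push_cast
  rfl

theorem ncard_shift_eq_triSum (k : ℕ) (u : ℤ × ℤ) (P : ℤ × ℤ → Prop) [DecidablePred P] :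
    (Set.ncard {x : ℤ × ℤ | (u.1 ≤ x.1 ∧ u.2 ≤ x.2 ∧ x.1 + x.2 + 1 ≤ (k : ℤ) + u.1 + u.2) ∧
        P x} : ℤ) =
      triSum k (fun r s => if P (((r : ℤ), (s : ℤ)) + u) then 1 else 0) := by
  rw [← ncard_eq_triSum k fun x => P (x + u), ← Set.ncard_image_of_injective
    {x : ℤ × ℤ | (0 ≤ x.1 ∧ 0 ≤ x.2 ∧ x.1 + x.2 + 1 ≤ (k : ℤ)) ∧ P (x + u)}
    (add_left_injective u)]
  congr 2
  ext x
  simp only [Set.mem_ofPred_eq, Set.mem_image]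
  constructor
  · rintro ⟨h, hP⟩
    refine ⟨x - u, ⟨?_, by simpa using hP⟩, by simp⟩
    simp only [Prod.fst_sub, Prod.snd_sub]
    omega
  · rintro ⟨y, ⟨h, hP⟩, rfl⟩
    refine ⟨?_, hP⟩
    simp only [Prod.fst_add, Prod.snd_add]
    omega

/-- The function on colors with values `w0`, `w1`, `w3`, `wm` at `0`, `1`, `3`, `m`. -/
def PColor.weight (w0 w1 w3 wm : ℤ) : PColor → ℤ
  | .c0 => w0
  | .c1 => w1
  | .c3 => w3
  | .cm => wm

/-- The indicator that three edges all have color `q`. -/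
def allColor (q a b c : PColor) : ℤ := if a = q ∧ b = q ∧ c = q then 1 else 0

/-- The number of edges of color `q` among three. -/
def countColor (q a b c : PColor) : ℤ :=
  (if a = q then 1 else 0) + (if b = q then 1 else 0) + (if c = q then 1 else 0)

theorem ncard_edges_eq_triSum (k : ℕ) (C : Fin 3 → ℤ × ℤ → PColor) (q : PColor) :
    (Set.ncard {p : Fin 3 × (ℤ × ℤ) | IsEdge k p.1 p.2 ∧ C p.1 p.2 = q} : ℤ) =
      triSum k (fun r s => countColor q (C 2 (r, s)) (C 1 (r, s + 1)) (C 0 (r + 1, s))) := by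
  have key : ∀ (ℓ : Fin 3) (u : ℤ × ℤ), (∀ y, IsEdge k ℓ y ↔
      u.1 ≤ y.1 ∧ u.2 ≤ y.2 ∧ y.1 + y.2 + 1 ≤ (k : ℤ) + u.1 + u.2) →
      ({y | IsEdge k ℓ y ∧ C ℓ y = q}.ncard : ℤ) =
        triSum k (fun r s => if C ℓ (((r : ℤ), (s : ℤ)) + u) = q then 1 else 0) := by
    intro ℓ u h
    simp only [h]
    exact ncard_shift_eq_triSum k u fun y => C ℓ y = q
  have h2 := key 2 (0, 0) fun y => by
    simp only [IsEdge, TGrid, edgeStep, Set.mem_ofPred_eq, Prod.fst_add, Prod.snd_add]; omega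
  have h1 := key 1 (0, 1) fun y => by
    simp only [IsEdge, TGrid, edgeStep, Set.mem_ofPred_eq, Prod.fst_add, Prod.snd_add]; omega
  have h0 := key 0 (1, 0) fun y => by
    simp only [IsEdge, TGrid, edgeStep, Set.mem_ofPred_eq, Prod.fst_add, Prod.snd_add]; omega
  have hfin : ∀ ℓ, {y | IsEdge k ℓ y ∧ C ℓ y = q}.Finite := fun ℓ =>
    (Set.finite_Icc ((0, 0) : ℤ × ℤ) (k, k)).subset fun y hy => by
      obtain ⟨⟨⟨h1, h2, h3⟩, -⟩, -⟩ := hy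
      simp only [Set.mem_Icc, Prod.le_def]
      omega
  have hcard : {p : Fin 3 × (ℤ × ℤ) | IsEdge k p.1 p.2 ∧ C p.1 p.2 = q}.ncard =
      ∑ ℓ : Fin 3, {y | IsEdge k ℓ y ∧ C ℓ y = q}.ncard := by
    have hset : {p : Fin 3 × (ℤ × ℤ) | IsEdge k p.1 p.2 ∧ C p.1 p.2 = q} =
        Equiv.sigmaEquivProd (Fin 3) (ℤ × ℤ) ''
          ((Finset.univ.sigma fun ℓ => (hfin ℓ).toFinset :
            Finset ((_ : Fin 3) × (ℤ × ℤ))) : Set ((_ : Fin 3) × (ℤ × ℤ))) := by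
      ext ⟨ℓ, y⟩
      simp [Equiv.sigmaEquivProd]
    rw [hset, Set.ncard_image_of_injective _ (Equiv.injective _), Set.ncard_coe_finset,
      Finset.card_sigma]
    exact Finset.sum_congr rfl fun ℓ _ => (Set.ncard_eq_toFinset_card _ (hfin ℓ)).symm
  rw [hcard, Fin.sum_univ_three]
  push_cast
  rw [h0, h1, h2]
  simp only [countColor, triSum_add, Prod.mk_add_mk, add_zero]
  ring

theorem okTriple.rotate {a b c : PColor} (h : okTriple a b c) : okTriple b c a := by
  rcases h with h | h | h | h | h | h | h | h <;> obtain ⟨rfl, rfl, rfl⟩ := h <;> simp [okTriple]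

/-- A coloring of the triangular grid of size `k + 1`, with boundary colors `B` on each side, whose
direct faces are `(a r s, b r s, c r s)` and whose reversed faces are
`(a (r + 1) s, b r s, c r (s + 1))`. -/
structure IsGridColoring (k : ℕ) (a b c : ℕ → ℕ → PColor) (B : ℕ → PColor) : Prop where
  direct : ∀ r s, r + s < k + 1 → okTriple (a r s) (b r s) (c r s)
  reversed : ∀ r s, r + s < k → okTriple (a (r + 1) s) (b r s) (c r (s + 1))
  left : ∀ i, i < k + 1 → a 0 i = B i
  diag : ∀ i, i < k + 1 → b i (k - i) = B i
  bottom : ∀ i, i < k + 1 → c i 0 = B i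
  bdry : ∀ i, B i = .c0 ∨ B i = .c1

namespace IsGridColoring

variable {k : ℕ} {a b c : ℕ → ℕ → PColor} {B : ℕ → PColor}

/-- Number of direct faces with constant color `q`. -/
def directAll (k : ℕ) (a b c : ℕ → ℕ → PColor) (q : PColor) : ℤ :=
  triSum (k + 1) fun r s => allColor q (a r s) (b r s) (c r s)

/-- Number of edges of color `q`, counted along direct faces. -/
def directCount (k : ℕ) (a b c : ℕ → ℕ → PColor) (q : PColor) : ℤ :=
  triSum (k + 1) fun r s => countColor q (a r s) (b r s) (c r s)

/-- Number of reversed faces with constant color `q`. -/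
def reversedAll (k : ℕ) (a b c : ℕ → ℕ → PColor) (q : PColor) : ℤ :=
  triSum k fun r s => allColor q (a (r + 1) s) (b r s) (c r (s + 1))

/-- Number of edges of color `q`, counted along reversed faces. -/
def reversedCount (k : ℕ) (a b c : ℕ → ℕ → PColor) (q : PColor) : ℤ :=
  triSum k fun r s => countColor q (a (r + 1) s) (b r s) (c r (s + 1))

/-- Stokes formula for an edge weight whose sum on each face is a fixed linear combination of the
tile indicators. -/
theorem stokes (H : IsGridColoring k a b c B) (f g h : ℕ → ℕ → PColor → ℤ)
    (x0 x1 x3 xm y0 y1 y3 ym : ℤ)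
    (hd : ∀ r s, r + s < k + 1 → f r s (a r s) + g r s (b r s) + h r s (c r s) =
      x0 * allColor .c0 (a r s) (b r s) (c r s) + x1 * allColor .c1 (a r s) (b r s) (c r s) +
      x3 * countColor .c3 (a r s) (b r s) (c r s) + xm * countColor .cm (a r s) (b r s) (c r s))
    (hr : ∀ r s, r + s < k →
      f (r + 1) s (a (r + 1) s) + g r s (b r s) + h r (s + 1) (c r (s + 1)) =
      y0 * allColor .c0 (a (r + 1) s) (b r s) (c r (s + 1)) +
      y1 * allColor .c1 (a (r + 1) s) (b r s) (c r (s + 1)) +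
      y3 * countColor .c3 (a (r + 1) s) (b r s) (c r (s + 1)) +
      ym * countColor .cm (a (r + 1) s) (b r s) (c r (s + 1))) :
    (x0 * directAll k a b c .c0 + x1 * directAll k a b c .c1 + x3 * directCount k a b c .c3 +
        xm * directCount k a b c .cm) -
      (y0 * reversedAll k a b c .c0 + y1 * reversedAll k a b c .c1 +
        y3 * reversedCount k a b c .c3 + ym * reversedCount k a b c .cm) =
      ∑ i ∈ Finset.range (k + 1), (f 0 i (B i) + g i (k - i) (B i) + h i 0 (B i)) := by
  have hs := triSum_stokes k (fun r s => f r s (a r s)) (fun r s => g r s (b r s))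
    (fun r s => h r s (c r s))
  rw [triSum_congr hd, triSum_congr hr] at hs
  simp only [triSum_add, triSum_const_mul] at hs
  refine hs.trans (Finset.sum_congr rfl fun i hi => ?_)
  rw [Finset.mem_range] at hi
  rw [H.left i hi, H.diag i hi, H.bottom i hi]

/-- A relation for edge weights that are explicit functions of the color. -/
theorem stokes_weight (H : IsGridColoring k a b c B) (f g h : ℕ → ℕ → PColor → ℤ)
    (x0 x1 x3 xm y0 y1 y3 ym : ℤ)
    (hd : ∀ r s, ∀ p q t, okTriple p q t → f r s p + g r s q + h r s t =
      x0 * allColor .c0 p q t + x1 * allColor .c1 p q t +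
      x3 * countColor .c3 p q t + xm * countColor .cm p q t)
    (hr : ∀ r s, ∀ p q t, okTriple p q t → f (r + 1) s p + g r s q + h r (s + 1) t =
      y0 * allColor .c0 p q t + y1 * allColor .c1 p q t +
      y3 * countColor .c3 p q t + ym * countColor .cm p q t) :
    (x0 * directAll k a b c .c0 + x1 * directAll k a b c .c1 + x3 * directCount k a b c .c3 +
        xm * directCount k a b c .cm) -
      (y0 * reversedAll k a b c .c0 + y1 * reversedAll k a b c .c1 +
        y3 * reversedCount k a b c .c3 + ym * reversedCount k a b c .cm) =
      ∑ i ∈ Finset.range (k + 1), (f 0 i (B i) + g i (k - i) (B i) + h i 0 (B i)) :=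
  H.stokes f g h x0 x1 x3 xm y0 y1 y3 ym (fun r s hrs => hd r s _ _ _ (H.direct r s hrs))
    fun r s hrs => hr r s _ _ _ (H.reversed r s hrs)

/-- Each edge of color `3` lies in one direct and one reversed face, and so does each edge of
color `m`. -/
theorem count_eq (H : IsGridColoring k a b c B) :
    directCount k a b c .c3 = reversedCount k a b c .c3 ∧
      directCount k a b c .cm = reversedCount k a b c .cm := by
  have key : ∀ w3 wm : ℤ, w3 * directCount k a b c .c3 + wm * directCount k a b c .cm =
      w3 * reversedCount k a b c .c3 + wm * reversedCount k a b c .cm := by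
    intro w3 wm
    have h := H.stokes_weight (fun _ _ => PColor.weight 0 0 w3 wm)
      (fun _ _ => PColor.weight 0 0 w3 wm) (fun _ _ => PColor.weight 0 0 w3 wm)
      0 0 w3 wm 0 0 w3 wm
      (by rintro r s p q t (h | h | h | h | h | h | h | h) <;> obtain ⟨rfl, rfl, rfl⟩ := h <;>
            simp [PColor.weight, allColor, countColor])
      (by rintro r s p q t (h | h | h | h | h | h | h | h) <;> obtain ⟨rfl, rfl, rfl⟩ := h <;>
            simp [PColor.weight, allColor, countColor])
    rw [Finset.sum_eq_zero fun i _ => by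
      rcases H.bdry i with h | h <;> simp [h, PColor.weight]] at h
    linarith
  have h3 := key 1 0
  have hm := key 0 1
  constructor <;> linarith

/-- Counting boundary edges by color. -/
theorem all_sub_all (H : IsGridColoring k a b c B) (w0 w1 : ℤ) :
    w0 * (directAll k a b c .c0 - reversedAll k a b c .c0) +
        w1 * (directAll k a b c .c1 - reversedAll k a b c .c1) =
      ∑ i ∈ Finset.range (k + 1), (B i).weight w0 w1 0 0 := by
  obtain ⟨h3, hm⟩ := H.count_eq
  have h := H.stokes_weight (fun _ _ => PColor.weight w0 w1 0 0)
    (fun _ _ => PColor.weight w0 w1 0 0) (fun _ _ => PColor.weight w0 w1 0 0)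
    (3 * w0) (3 * w1) (w0 + w1) (w0 + w1) (3 * w0) (3 * w1) (w0 + w1) (w0 + w1)
    (by rintro r s p q t (h | h | h | h | h | h | h | h) <;> obtain ⟨rfl, rfl, rfl⟩ := h <;>
          simp [PColor.weight, allColor, countColor] <;> ring)
    (by rintro r s p q t (h | h | h | h | h | h | h | h) <;> obtain ⟨rfl, rfl, rfl⟩ := h <;>
          simp [PColor.weight, allColor, countColor] <;> ring)
  simp only [Finset.sum_add_distrib] at h
  rw [h3, hm] at h
  linarith

/-- Sum of the heights of the boundary edges of color `0`. -/
theorem height_zero (H : IsGridColoring k a b c B) :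
    (2 * k + 3) * directAll k a b c .c0 - (2 * k + 1) * reversedAll k a b c .c0 +
        directCount k a b c .cm + reversedCount k a b c .cm =
      ∑ i ∈ Finset.range (k + 1), (B i).weight (2 * k + 2 * i + 3) 0 0 0 := by
  have h := H.stokes_weight
    (fun r s => PColor.weight (2 * s + 1) 0 (-(2 * (k + 1 - r - s) - 1)) (-(2 * r)))
    (fun r s => PColor.weight (2 * r + 1) 0 (-(2 * s + 1)) (-(2 * (k - r - s))))
    (fun r s => PColor.weight (2 * (k - r - s) + 1) 0 (-(2 * r + 1)) (-(2 * s)))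
    (2 * k + 3) 0 0 1 (2 * k + 1) 0 0 (-1)
    (by rintro r s p q t (h | h | h | h | h | h | h | h) <;> obtain ⟨rfl, rfl, rfl⟩ := h <;>
          simp [PColor.weight, allColor, countColor] <;> ring)
    (by rintro r s p q t (h | h | h | h | h | h | h | h) <;> obtain ⟨rfl, rfl, rfl⟩ := h <;>
          simp [PColor.weight, allColor, countColor] <;> ring)
  rw [Finset.sum_congr rfl (g := fun i : ℕ => (B i).weight (2 * k + 2 * i + 3) 0 0 0)] at h
  · linarith
  · intro i _
    rcases H.bdry i with h | h <;> simp [h, PColor.weight]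
    ring

/-- Sum of the heights of the boundary edges of color `1`. -/
theorem height_one (H : IsGridColoring k a b c B) :
    (2 * k + 3) * directAll k a b c .c1 - (2 * k + 1) * reversedAll k a b c .c1 +
        directCount k a b c .c3 + reversedCount k a b c .c3 =
      ∑ i ∈ Finset.range (k + 1), (B i).weight 0 (2 * k + 2 * i + 3) 0 0 := by
  have h := H.stokes_weight
    (fun r s => PColor.weight 0 (2 * s + 1) (-(2 * r)) (-(2 * (k + 1 - r - s) - 1)))
    (fun r s => PColor.weight 0 (2 * r + 1) (-(2 * (k - r - s))) (-(2 * s + 1)))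
    (fun r s => PColor.weight 0 (2 * (k - r - s) + 1) (-(2 * s)) (-(2 * r + 1)))
    0 (2 * k + 3) 1 0 0 (2 * k + 1) (-1) 0
    (by rintro r s p q t (h | h | h | h | h | h | h | h) <;> obtain ⟨rfl, rfl, rfl⟩ := h <;>
          simp [PColor.weight, allColor, countColor] <;> ring)
    (by rintro r s p q t (h | h | h | h | h | h | h | h) <;> obtain ⟨rfl, rfl, rfl⟩ := h <;>
          simp [PColor.weight, allColor, countColor] <;> ring)
  rw [Finset.sum_congr rfl (g := fun i : ℕ => (B i).weight 0 (2 * k + 2 * i + 3) 0 0)] at h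
  · linarith
  · intro i _
    rcases H.bdry i with h | h <;> simp [h, PColor.weight]
    ring

/-- Sum of the complementary heights of the boundary edges of color `0`. -/
theorem coheight_zero (H : IsGridColoring k a b c B) :
    (2 * k + 3) * directAll k a b c .c0 - (2 * k + 1) * reversedAll k a b c .c0 +
        directCount k a b c .c3 + reversedCount k a b c .c3 =
      ∑ i ∈ Finset.range (k + 1), (B i).weight (4 * k + 3 - 2 * i) 0 0 0 := by
  have h := H.stokes_weight
    (fun r s => PColor.weight (2 * (k + 1 - r - s) - 1) 0 (-(2 * r)) (-(2 * s + 1)))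
    (fun r s => PColor.weight (2 * s + 1) 0 (-(2 * (k - r - s))) (-(2 * r + 1)))
    (fun r s => PColor.weight (2 * r + 1) 0 (-(2 * s)) (-(2 * (k - r - s) + 1)))
    (2 * k + 3) 0 1 0 (2 * k + 1) 0 (-1) 0
    (by rintro r s p q t (h | h | h | h | h | h | h | h) <;> obtain ⟨rfl, rfl, rfl⟩ := h <;>
          simp [PColor.weight, allColor, countColor] <;> ring)
    (by rintro r s p q t (h | h | h | h | h | h | h | h) <;> obtain ⟨rfl, rfl, rfl⟩ := h <;>
          simp [PColor.weight, allColor, countColor] <;> ring)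
  rw [Finset.sum_congr rfl (g := fun i : ℕ => (B i).weight (4 * k + 3 - 2 * i) 0 0 0)] at h
  · linarith
  · intro i hi
    have : i ≤ k := by simpa [Nat.lt_succ_iff] using hi
    rcases H.bdry i with h | h <;> simp [h, PColor.weight, Nat.cast_sub this]
    ring

/-- First coordinate of the developing map that contracts the edges of color `1`. -/
def potential (c : ℕ → ℕ → PColor) (r s : ℕ) : ℤ :=
  ∑ i ∈ Finset.range r, (c i s).weight 1 0 1 0

theorem potential_zero (c : ℕ → ℕ → PColor) (s : ℕ) : potential c 0 s = 0 := by
  simp [potential]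

theorem potential_succ_left (c : ℕ → ℕ → PColor) (r s : ℕ) :
    potential c (r + 1) s = potential c r s + (c r s).weight 1 0 1 0 :=
  Finset.sum_range_succ _ _

theorem potential_succ_right (H : IsGridColoring k a b c B) (r s : ℕ) (hrs : r + s < k + 1) :
    potential c r (s + 1) = potential c r s + (a r s).weight 0 0 1 (-1) := by
  induction r with
  | zero =>
    rw [potential_zero, potential_zero, H.left s (by omega)]
    rcases H.bdry s with h | h <;> simp [h, PColor.weight]
  | succ r ih =>
    have hp := ih (by omega)
    rw [potential_succ_left, potential_succ_left, hp]
    have h1 := H.direct r s (by omega)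
    have h2 := H.reversed r s (by omega)
    rcases h1 with h | h | h | h | h | h | h | h <;> obtain ⟨ha, hb, hc⟩ := h <;>
      rw [hb] at h2 <;> rw [ha, hc] <;>
      rcases h2 with h | h | h | h | h | h | h | h <;> obtain ⟨h1, h2, h3⟩ := h <;>
      first
      | contradiction
      | simp [h1, h3, PColor.weight]

theorem potential_diag (H : IsGridColoring k a b c B) (r s : ℕ) (hrs : r + s < k + 1) :
    potential c (r + 1) s = potential c r (s + 1) + (b r s).weight 1 0 0 1 := by
  rw [potential_succ_left, H.potential_succ_right r s hrs]
  rcases H.direct r s hrs with h | h | h | h | h | h | h | h <;> obtain ⟨ha, hb, hc⟩ := h <;>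
    simp [ha, hb, hc, PColor.weight]

theorem potential_side (H : IsGridColoring k a b c B) (i : ℕ) (hi : i ≤ k + 1) :
    potential c i (k + 1 - i) = ∑ j ∈ Finset.range i, (B j).weight 1 0 0 0 := by
  induction i with
  | zero => simp [potential_zero]
  | succ i ih =>
    have h := H.potential_diag i (k - i) (by omega)
    rw [H.diag i (by omega), ← Nat.sub_add_comm (by omega), ih (by omega)] at h
    rw [Nat.add_sub_add_right, h, Finset.sum_range_succ]
    rcases H.bdry i with h | h <;> simp [h, PColor.weight]

theorem sum_weight_mul_sq (w : ℕ → ℤ) (hw : ∀ i, w i = 0 ∨ w i = 1) (m : ℕ) :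
    ∑ i ∈ Finset.range m, w i * (2 * ∑ j ∈ Finset.range i, w j + 1) =
      (∑ j ∈ Finset.range m, w j) ^ 2 := by
  induction m with
  | zero => simp
  | succ m ih =>
    rw [Finset.sum_range_succ, ih, Finset.sum_range_succ]
    rcases hw m with h | h <;> rw [h] <;> ring

/-- The faces of color `0` are glued into a triangle by the developing map. -/
theorem area_zero (H : IsGridColoring k a b c B) :
    directAll k a b c .c0 + reversedAll k a b c .c0 =
      (∑ i ∈ Finset.range (k + 1), (B i).weight 1 0 0 0) ^ 2 := by
  have h := H.stokes
    (fun r s => PColor.weight (potential c r s + potential c r (s + 1)) 0 0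
      (potential c r s + potential c r (s + 1)))
    (fun r s => PColor.weight (-(potential c r (s + 1) + potential c (r + 1) s)) 0
      (-(potential c r (s + 1) + potential c (r + 1) s)) 0)
    (fun r s => PColor.weight 0 0 (potential c (r + 1) s + potential c r s)
      (-(potential c (r + 1) s + potential c r s)))
    (-1) 0 0 0 1 0 0 0
    (by
      intro r s hrs
      rw [potential_succ_left, H.potential_succ_right r s hrs]
      rcases H.direct r s hrs with h | h | h | h | h | h | h | h <;>
        obtain ⟨ha, hb, hc⟩ := h <;>
        simp [ha, hb, hc, PColor.weight, allColor, countColor] <;> ring)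
    (by
      intro r s hrs
      rw [H.potential_succ_right (r + 1) s (by omega), H.potential_diag r s (by omega)]
      rcases H.reversed r s hrs with h | h | h | h | h | h | h | h <;>
        obtain ⟨ha, hb, hc⟩ := h <;>
        simp [ha, hb, hc, PColor.weight, allColor, countColor] <;> ring)
  rw [← sum_weight_mul_sq _ fun i => by
    rcases H.bdry i with h | h <;> simp [h, PColor.weight]]
  rw [Finset.sum_congr rfl (g := fun i : ℕ => -((B i).weight 1 0 0 0 *
    (2 * ∑ j ∈ Finset.range i, (B j).weight 1 0 0 0 + 1)))] at h
  · rw [Finset.sum_neg_distrib] at h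
    linarith
  · intro i hi
    have hik : i ≤ k := by simpa [Nat.lt_succ_iff] using hi
    rw [← H.potential_side i (by omega), H.potential_diag i (k - i) (by omega),
      H.diag i (by omega), ← Nat.sub_add_comm hik]
    simp only [potential_zero]
    rcases H.bdry i with h | h <;> simp [h, PColor.weight]
    ring

end IsGridColoring

theorem bCol_eq (n d : ℕ) (h : ℤ) : bCol n d h = .c0 ∨ bCol n d h = .c1 := by
  unfold bCol
  split_ifs <;> simp

theorem sum_weight_bCol (d e : ℕ) (v w : ℕ → ℤ) :
    ∑ i ∈ Finset.range (d + e + d), (bCol (d + e) d i).weight (v i) (w i) 0 0 =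
      ∑ i ∈ Finset.range d, w i + ∑ i ∈ Finset.range e, v (d + i) +
        ∑ i ∈ Finset.range d, w (d + e + i) := by
  rw [Finset.sum_range_add, Finset.sum_range_add]
  congr 1
  · congr 1
    · refine Finset.sum_congr rfl fun i hi => ?_
      rw [Finset.mem_range] at hi
      rw [bCol, if_pos (by omega), PColor.weight]
    · refine Finset.sum_congr rfl fun i hi => ?_
      rw [Finset.mem_range] at hi
      rw [bCol, if_neg (by omega), if_pos (by omega), PColor.weight]
  · refine Finset.sum_congr rfl fun i hi => ?_
    rw [bCol, if_neg (by omega), if_neg (by omega), PColor.weight]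

theorem sum_range_affine (x y : ℤ) (m : ℕ) :
    ∑ i ∈ Finset.range m, (x + 2 * y * i) = m * x + y * (m * (m - 1)) := by
  induction m with
  | zero => simp
  | succ m ih =>
    rw [Finset.sum_range_succ, ih]
    push_cast
    ring

theorem IsRegularColorMap.isGridColoring {n d k : ℕ} (hk : n + d = k + 1)
    {C : Fin 3 → ℤ × ℤ → PColor} (hC : IsRegularColorMap n d C) :
    IsGridColoring k (fun r s => C 2 (r, s)) (fun r s => C 1 (r, s + 1))
      (fun r s => C 0 (r + 1, s)) (fun i => bCol n d i) := by
  obtain ⟨⟨hd, hr⟩, h0, h1, h2⟩ := hC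
  refine ⟨fun r s hrs => ?_, fun r s hrs => ?_, fun i hi => ?_, fun i hi => ?_, fun i hi => ?_,
    fun i => bCol_eq _ _ _⟩
  · simpa using hd (r, s) (by simp) (by simp) (by rw [hk]; dsimp only; omega)
  · simpa using (hr (r, s + 1) (by simp) (by dsimp only; omega)
      (by rw [hk]; dsimp only; push_cast; omega)).rotate
  · exact h2 i (by omega) (by omega)
  · rw [← h1 i (by omega) (by omega)]
    congr 2
    omega
  · have h := h0 (k - i) (by omega) (by omega)
    rw [show (n : ℤ) + d - (k - i) = i + 1 by omega] at h
    simp only [Nat.cast_zero]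
    rw [h, bCol, bCol]
    split_ifs <;> first | rfl | omega

/-- **Tiles enumeration.** -/
theorem statement15 (n d : ℕ) (hn : 1 ≤ n) (hdn : d ≤ n)
    (C : Fin 3 → ℤ × ℤ → PColor) (hC : IsRegularColorMap n d C) :
    Set.ncard {p : Fin 3 × (ℤ × ℤ) | IsEdge (n + d) p.1 p.2 ∧ C p.1 p.2 = .cm}
        = d * (n - d) ∧
    Set.ncard {p : Fin 3 × (ℤ × ℤ) | IsEdge (n + d) p.1 p.2 ∧ C p.1 p.2 = .c3}
        = d * (n - d) ∧
    Set.ncard {x : ℤ × ℤ | 0 ≤ x.1 ∧ 0 ≤ x.2 ∧ x.1 + x.2 + 1 ≤ ((n : ℤ) + d) ∧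
        C 2 x = .c0 ∧ C 1 (x + (0, 1)) = .c0 ∧ C 0 (x + (1, 0)) = .c0}
      = (n - d) * (n - d + 1) / 2 ∧
    Set.ncard {x : ℤ × ℤ | 0 ≤ x.1 ∧ 1 ≤ x.2 ∧ x.1 + x.2 + 1 ≤ ((n : ℤ) + d) ∧
        C 0 (x + (1, 0)) = .c0 ∧ C 2 (x + (1, -1)) = .c0 ∧ C 1 x = .c0}
      = (n - d) * (n - d - 1) / 2 ∧
    Set.ncard {x : ℤ × ℤ | 0 ≤ x.1 ∧ 0 ≤ x.2 ∧ x.1 + x.2 + 1 ≤ ((n : ℤ) + d) ∧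
        C 2 x = .c1 ∧ C 1 (x + (0, 1)) = .c1 ∧ C 0 (x + (1, 0)) = .c1}
      = d * (2 * d + 1) ∧
    Set.ncard {x : ℤ × ℤ | 0 ≤ x.1 ∧ 1 ≤ x.2 ∧ x.1 + x.2 + 1 ≤ ((n : ℤ) + d) ∧
        C 0 (x + (1, 0)) = .c1 ∧ C 2 (x + (1, -1)) = .c1 ∧ C 1 x = .c1}
      = d * (2 * d - 1) := by
  obtain ⟨e, rfl⟩ := Nat.exists_eq_add_of_le hdn
  obtain ⟨k, hk⟩ : ∃ k, d + e + d = k + 1 := ⟨d + e + d - 1, by omega⟩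
  have H := hC.isGridColoring hk
  obtain ⟨h3, hm⟩ := H.count_eq
  have hs0 := H.all_sub_all 1 0
  have hs1 := H.all_sub_all 0 1
  have hh0 := H.height_zero
  have hh1 := H.height_one
  have hc0 := H.coheight_zero
  have ha0 := H.area_zero
  have hcast : (k : ℤ) = 2 * d + e - 1 := by omega
  have e3 := ncard_edges_eq_triSum (d + e + d) C .c3
  have em := ncard_edges_eq_triSum (d + e + d) C .cm
  have hD : ∀ q, (Set.ncard {x : ℤ × ℤ | 0 ≤ x.1 ∧ 0 ≤ x.2 ∧
      x.1 + x.2 + 1 ≤ (((d + e : ℕ) : ℤ) + d) ∧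
      C 2 x = q ∧ C 1 (x + (0, 1)) = q ∧ C 0 (x + (1, 0)) = q} : ℤ) =
      IsGridColoring.directAll k (fun r s => C 2 (r, s)) (fun r s => C 1 (r, s + 1))
        (fun r s => C 0 (r + 1, s)) q := by
    intro q
    have h := ncard_eq_triSum (k + 1)
      fun x => C 2 x = q ∧ C 1 (x + (0, 1)) = q ∧ C 0 (x + (1, 0)) = q
    rw [← hk] at h
    simp only [and_assoc, Prod.mk_add_mk, add_zero, Nat.cast_add] at h
    simp only [Nat.cast_add]
    rw [h, IsGridColoring.directAll, ← hk]
    rfl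
  have hR : ∀ q, (Set.ncard {x : ℤ × ℤ | 0 ≤ x.1 ∧ 1 ≤ x.2 ∧
      x.1 + x.2 + 1 ≤ (((d + e : ℕ) : ℤ) + d) ∧
      C 0 (x + (1, 0)) = q ∧ C 2 (x + (1, -1)) = q ∧ C 1 x = q} : ℤ) =
      IsGridColoring.reversedAll k (fun r s => C 2 (r, s)) (fun r s => C 1 (r, s + 1))
        (fun r s => C 0 (r + 1, s)) q := by
    intro q
    have h := ncard_shift_eq_triSum k (0, 1)
      fun x => C 0 (x + (1, 0)) = q ∧ C 2 (x + (1, -1)) = q ∧ C 1 x = q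
    have hk' : (k : ℤ) + 0 + 1 = ((d + e : ℕ) : ℤ) + d := by push_cast; omega
    simp only [hk', and_assoc] at h
    rw [h, IsGridColoring.reversedAll]
    refine triSum_congr fun r s _ => ?_
    simp only [allColor, Prod.mk_add_mk, add_zero, add_neg_cancel_right, Nat.cast_add,
      Nat.cast_one]
    refine if_congr ?_ rfl rfl
    tauto
  rw [hk] at e3 em
  change _ = IsGridColoring.directCount k _ _ _ _ at e3 em
  rw [← hk] at e3 em hs0 hs1 hh0 hh1 hc0 ha0
  rw [sum_weight_bCol d e (fun _ => 1) fun _ => 0] at hs0 ha0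
  rw [sum_weight_bCol d e (fun _ => 0) fun _ => 1] at hs1
  rw [sum_weight_bCol d e (fun i => 2 * k + 2 * i + 3) fun _ => 0] at hh0
  rw [sum_weight_bCol d e (fun _ => 0) fun i => 2 * k + 2 * i + 3] at hh1
  rw [sum_weight_bCol d e (fun i => 4 * k + 3 - 2 * i) fun _ => 0] at hc0
  have sA : ∑ i ∈ Finset.range e, (2 * (k : ℤ) + 2 * ((d + i : ℕ) : ℤ) + 3) =
      e * (2 * k + 2 * d + 3) + e * (e - 1) :=
    (Finset.sum_congr rfl fun i _ => by push_cast; ring).trans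
      ((sum_range_affine (2 * k + 2 * d + 3) 1 e).trans (by ring))
  have sB : ∑ i ∈ Finset.range e, (4 * (k : ℤ) + 3 - 2 * ((d + i : ℕ) : ℤ)) =
      e * (4 * k + 3 - 2 * d) - e * (e - 1) :=
    (Finset.sum_congr rfl fun i _ => by push_cast; ring).trans
      ((sum_range_affine (4 * k + 3 - 2 * d) (-1) e).trans (by ring))
  have sC : ∑ i ∈ Finset.range d, (2 * (k : ℤ) + 2 * (i : ℤ) + 3) =
      d * (2 * k + 3) + d * (d - 1) :=
    (Finset.sum_congr rfl fun i _ => by ring).trans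
      ((sum_range_affine (2 * k + 3) 1 d).trans (by ring))
  have sD : ∑ i ∈ Finset.range d, (2 * (k : ℤ) + 2 * ((d + e + i : ℕ) : ℤ) + 3) =
      d * (2 * k + 2 * d + 2 * e + 3) + d * (d - 1) :=
    (Finset.sum_congr rfl fun i _ => by push_cast; ring).trans
      ((sum_range_affine (2 * k + 2 * d + 2 * e + 3) 1 d).trans (by ring))
  simp only [Finset.sum_const_zero, Finset.sum_const, Finset.card_range, nsmul_eq_mul, mul_one,
    zero_add, add_zero, sA, sB, sC, sD] at hs0 hs1 hh0 hh1 hc0 ha0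
  rw [← h3, hcast] at hh1 hc0
  rw [← hm, hcast] at hh0
  rw [← e3] at hh1 hc0
  rw [← em] at hh0
  simp only [← hD, ← hR] at hs0 hs1 hh0 hh1 hc0 ha0
  rw [Nat.add_sub_cancel_left]
  have half : ∀ x y : ℤ, 2 * x = 2 * y → x = y := fun x y h => by omega
  have cast_e : ((e - 1 : ℕ) : ℤ) * e = (e - 1) * e := by cases e <;> simp
  have cast_d : ((2 * d - 1 : ℕ) : ℤ) * d = (2 * d - 1) * d := by
    rcases Nat.eq_zero_or_pos d with rfl | h
    · simp
    · rw [Nat.cast_sub (by omega)]; simp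
  refine ⟨?_, ?_, ?_, ?_, ?_, ?_⟩
  · rw [← Nat.cast_inj (R := ℤ), Nat.cast_mul]
    apply half
    linear_combination hh0 - ha0 - (4 * d + 2 * e) * hs0
  · rw [← Nat.cast_inj (R := ℤ), Nat.cast_mul]
    apply half
    linear_combination hc0 - ha0 - (4 * d + 2 * e) * hs0
  · refine (Nat.div_eq_of_eq_mul_left two_pos ?_).symm
    rw [← Nat.cast_inj (R := ℤ), Nat.cast_mul, Nat.cast_mul, Nat.cast_add_one, Nat.cast_two]
    linear_combination -ha0 - hs0
  · refine (Nat.div_eq_of_eq_mul_left two_pos ?_).symm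
    rw [← Nat.cast_inj (R := ℤ), Nat.cast_mul, Nat.cast_mul, Nat.cast_two]
    linear_combination cast_e - ha0 + hs0
  · rw [← Nat.cast_inj (R := ℤ), Nat.cast_mul, Nat.cast_add_one, Nat.cast_mul, Nat.cast_two]
    apply half
    linear_combination hh1 - (4 * d + 2 * e) * hs1 + hs1 -
      (hc0 - ha0 - (4 * d + 2 * e) * hs0)
  · rw [← Nat.cast_inj (R := ℤ), Nat.cast_mul]
    apply half
    linear_combination hh1 - (4 * d + 2 * e) * hs1 - hs1 -
      (hc0 - ha0 - (4 * d + 2 * e) * hs0) - 2 * cast_d
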